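/- arXiv:1704.00857 — 10 statements merged into one kernel-verified Lean document; each statement's English description precedes it below -/
import Mathlib

section
/- For every real number R ≥ 37 there exist infinitely differentiable functions σ, τ : ℝ → ℝ such that: (i) for all r ≥ 0 one has σ(r) ≥ 0, τ(r) ≥ 0, σ'(r) ≥ 1, τ'(r) ≥ 0, σ''(r) ≥ 0 and τ''(r) ≥ 0; (ii) σ(r) = sinh(r) and τ(r) = cosh(r) for all r ≥ R; and (iii) σ(r) = r and τ(r) = 1 for all r with 0 ≤ r ≤ 1/R. -/
/-- A smooth function on `ℝ` has a smooth antiderivative with any prescribed value at a point. -/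
theorem exists_contDiff_antiderivative {f : ℝ → ℝ} (hf : ContDiff ℝ (⊤ : ℕ∞) f) (a v : ℝ) :
    ∃ F : ℝ → ℝ, ContDiff ℝ (⊤ : ℕ∞) F ∧ F a = v ∧ ∀ x, HasDerivAt F (f x) x := by
  have hd : ∀ x, HasDerivAt (fun x => v + ∫ t in a..x, f t) (f x) x := fun x =>
    (hf.continuous.integral_hasStrictDerivAt a x).hasDerivAt.const_add v
  refine ⟨fun x => v + ∫ t in a..x, f t, ?_, by simp, hd⟩
  rw [contDiff_infty_iff_deriv]
  refine ⟨fun x => (hd x).differentiableAt, ?_⟩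
  rwa [funext fun x => (hd x).deriv]

theorem le_of_hasDerivAt_nonneg_of_le {F f : ℝ → ℝ} (hF : ∀ x, HasDerivAt F (f x) x) {a b : ℝ}
    (hab : a ≤ b) (hf : ∀ x, a ≤ x → x ≤ b → 0 ≤ f x) : F a ≤ F b := by
  have hmono : MonotoneOn F (Set.Icc a b) := by
    refine monotoneOn_of_deriv_nonneg (convex_Icc a b)
      (fun x _ => (hF x).continuousAt.continuousWithinAt)
      (fun x _ => (hF x).differentiableAt.differentiableWithinAt) fun x hx => ?_
    rw [interior_Icc] at hx
    rw [(hF x).deriv]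
    exact hf x hx.1.le hx.2.le
  exact hmono ⟨le_rfl, hab⟩ ⟨hab, le_rfl⟩ hab

theorem eq_of_hasDerivAt_zero_of_le {F f : ℝ → ℝ} (hF : ∀ x, HasDerivAt F (f x) x) {a b : ℝ}
    (hab : a ≤ b) (hf : ∀ x, a ≤ x → x ≤ b → f x = 0) : F a = F b := by
  refine le_antisymm (le_of_hasDerivAt_nonneg_of_le hF hab fun x h₁ h₂ => (hf x h₁ h₂).ge) ?_
  have := le_of_hasDerivAt_nonneg_of_le (fun x => (hF x).neg) hab
    fun x h₁ h₂ => by simp [hf x h₁ h₂]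
  simpa using this

/-- A smooth convex version of the positive part: it vanishes on `(-∞, 0]` and is a translate of the
identity on `[1, ∞)`. -/
theorem exists_smooth_posPart :
    ∃ (m : ℝ → ℝ) (c : ℝ), ContDiff ℝ (⊤ : ℕ∞) m ∧ 0 ≤ c ∧ c ≤ 1 ∧
      (∀ x, HasDerivAt m (Real.smoothTransition x) x) ∧
      (∀ x, x ≤ 0 → m x = 0) ∧ (∀ x, 1 ≤ x → m x = x - c) := by
  obtain ⟨m, hm, hm0, hd⟩ :=
    exists_contDiff_antiderivative (Real.smoothTransition.contDiff (n := (⊤ : ℕ∞))) 0 0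
  have hd' : ∀ x, HasDerivAt (fun x => x - m x) (1 - Real.smoothTransition x) x :=
    fun x => (hasDerivAt_id x).sub (hd x)
  have h₁ := le_of_hasDerivAt_nonneg_of_le hd zero_le_one
    fun x _ _ => Real.smoothTransition.nonneg x
  have h₂ := le_of_hasDerivAt_nonneg_of_le hd' zero_le_one
    fun x _ _ => sub_nonneg.2 (Real.smoothTransition.le_one x)
  refine ⟨m, 1 - m 1, hm, by simp only [hm0] at h₂; linarith, by linarith, hd, fun x hx => ?_,
    fun x hx => ?_⟩
  · rw [← hm0]
    exact eq_of_hasDerivAt_zero_of_le hd hx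
      fun y _ hy => Real.smoothTransition.zero_of_nonpos hy
  · have := eq_of_hasDerivAt_zero_of_le hd' hx
      fun y hy _ => by rw [Real.smoothTransition.one_of_one_le hy, sub_self]
    linarith

/-- Extend `g` from `[R, ∞)` to a smooth convex function that is affine to the left of `R - 1` and
lies below the line of slope `g' (R - 1)` through `(R, g R)`. -/
theorem exists_convex_extension {g g' g'' : ℝ → ℝ} (hg'' : ContDiff ℝ (⊤ : ℕ∞) g'')
    (hg : ∀ x, HasDerivAt g (g' x) x) (hg' : ∀ x, HasDerivAt g' (g'' x) x)
    (hpos : ∀ x, 0 ≤ x → 0 ≤ g'' x) {R : ℝ} (hR : 1 ≤ R) :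
    ∃ u u' u'' : ℝ → ℝ, ContDiff ℝ (⊤ : ℕ∞) u ∧ (∀ x, HasDerivAt u (u' x) x) ∧
      (∀ x, HasDerivAt u' (u'' x) x) ∧ (∀ x, 0 ≤ x → 0 ≤ u'' x) ∧
      (∀ x, R ≤ x → u x = g x) ∧
      (∀ x, 0 ≤ x → x ≤ R → u x ≤ g R - g' (R - 1) * (R - x)) := by
  let ψ : ℝ → ℝ := fun x => Real.smoothTransition (x - R + 1)
  have hψ : ContDiff ℝ (⊤ : ℕ∞) ψ :=
    Real.smoothTransition.contDiff.comp ((contDiff_id.sub contDiff_const).add contDiff_const)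
  have hψ0 : ∀ x, x ≤ R - 1 → ψ x = 0 := fun x hx =>
    Real.smoothTransition.zero_of_nonpos (by linarith)
  have hψ1 : ∀ x, R ≤ x → ψ x = 1 := fun x hx =>
    Real.smoothTransition.one_of_one_le (by linarith)
  have hψnn : ∀ x, 0 ≤ ψ x := fun x => Real.smoothTransition.nonneg _
  have hψle : ∀ x, ψ x ≤ 1 := fun x => Real.smoothTransition.le_one _
  obtain ⟨u', hu'c, hu'R, hu'⟩ := exists_contDiff_antiderivative (hψ.mul hg'') R (g' R)
  obtain ⟨u, huc, huR, hu⟩ := exists_contDiff_antiderivative hu'c R (g R)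
  have hnn : ∀ x, 0 ≤ x → 0 ≤ ψ x * g'' x := fun x hx => mul_nonneg (hψnn x) (hpos x hx)
  have hdiff : ∀ x, HasDerivAt (fun x => g' x - u' x) (g'' x - ψ x * g'' x) x :=
    fun x => (hg' x).sub (hu' x)
  have hu'_eq : ∀ x, R ≤ x → u' x = g' x := fun x hx => by
    have := eq_of_hasDerivAt_zero_of_le hdiff hx fun y hy _ => by rw [hψ1 y hy]; ring
    simp only [hu'R] at this
    linarith
  have hslope : g' (R - 1) ≤ u' (R - 1) := by
    have := le_of_hasDerivAt_nonneg_of_le hdiff (sub_le_self R zero_le_one) fun y hy _ => by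
      nlinarith [hψle y, hpos y (by linarith)]
    simp only [hu'R] at this
    linarith
  have hslope' : ∀ x, 0 ≤ x → g' (R - 1) ≤ u' x := fun x hx => by
    rcases le_total x (R - 1) with h | h
    · rwa [eq_of_hasDerivAt_zero_of_le hu' h fun y _ hy => by simp [hψ0 y hy]]
    · exact hslope.trans
        (le_of_hasDerivAt_nonneg_of_le hu' h fun y hy _ => hnn y (by linarith))
  refine ⟨u, u', _, huc, hu, hu', hnn, fun x hx => ?_, fun x hx hxR => ?_⟩
  · have := eq_of_hasDerivAt_zero_of_le (fun x => (hg x).sub (hu x)) hx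
      fun y hy _ => by rw [hu'_eq y hy, sub_self]
    simp only [Pi.sub_apply, huR] at this
    linarith
  · have := le_of_hasDerivAt_nonneg_of_le
      (fun y => (hu y).sub ((hasDerivAt_id y).const_mul (g' (R - 1)))) hxR
      fun y hy _ => by linarith [hslope' y (hx.trans hy)]
    simp only [Pi.sub_apply, id, huR] at this
    linarith

/-- Convex smooth interpolation between the line `x ↦ p * x + q` near `0` and a convex function `g`
on `[R, ∞)`. -/
theorem exists_convex_interpolation {g g' g'' : ℝ → ℝ} (hg'' : ContDiff ℝ (⊤ : ℕ∞) g'')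
    (hg : ∀ x, HasDerivAt g (g' x) x) (hg' : ∀ x, HasDerivAt g' (g'' x) x)
    (hpos : ∀ x, 0 ≤ x → 0 ≤ g'' x) {R a p q : ℝ} (hR : 1 ≤ R) (ha : 0 ≤ a) (haR : a ≤ R)
    (hp : 0 ≤ p) (hq : 0 ≤ q) (hlarge : ∀ x, R ≤ x → p * x + q + 1 ≤ g x)
    (hslope : p ≤ g' (R - 1))
    (hsmall : g R - (p * R + q) + 1 ≤ (g' (R - 1) - p) * (R - a)) :
    ∃ f : ℝ → ℝ, ContDiff ℝ (⊤ : ℕ∞) f ∧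
      (∀ r, 0 ≤ r → 0 ≤ f r ∧ p ≤ deriv f r ∧ 0 ≤ deriv (deriv f) r) ∧
      (∀ r, R ≤ r → f r = g r) ∧ (∀ r, 0 ≤ r → r ≤ a → f r = p * r + q) := by
  obtain ⟨m, c, hm, hc0, hc1, hmd, hm0, hm1⟩ := exists_smooth_posPart
  obtain ⟨u, u', u'', huc, hu, hu', hu'', huR, hub⟩ :=
    exists_convex_extension hg'' hg hg' hpos hR
  let w : ℝ → ℝ := fun x => u x - (p * x + q) + c
  have hline : ∀ x, HasDerivAt (fun x => p * x + q) p x := fun x => by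
    simpa using ((hasDerivAt_id x).const_mul p).add_const q
  have hw : ∀ x, HasDerivAt w (u' x - p) x := fun x => ((hu x).sub (hline x)).add_const c
  have hlinec : ContDiff ℝ (⊤ : ℕ∞) fun x : ℝ => p * x + q := by fun_prop
  have hwc : ContDiff ℝ (⊤ : ℕ∞) w := (huc.sub hlinec).add contDiff_const
  have hw0 : ∀ x, 0 ≤ x → x ≤ a → w x ≤ 0 := fun x hx hxa => by
    have h₁ := hub x hx (hxa.trans haR)
    have h₂ := mul_le_mul_of_nonneg_left hxa (sub_nonneg.2 hslope)
    simp only [w]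
    nlinarith
  let S := Real.smoothTransition
  let f : ℝ → ℝ := fun x => p * x + q + m (w x)
  let f' : ℝ → ℝ := fun x => p + S (w x) * (u' x - p)
  have hf : ∀ x, HasDerivAt f (f' x) x := fun x => (hline x).add ((hmd (w x)).comp x (hw x))
  have hS : ∀ x, HasDerivAt S (deriv S x) x := fun x =>
    ((Real.smoothTransition.contDiff (n := 1)).differentiable one_ne_zero x).hasDerivAt
  have hf' : ∀ x, HasDerivAt f'
      (deriv S (w x) * (u' x - p) * (u' x - p) + S (w x) * u'' x) x := fun x =>
    (((hS (w x)).comp x (hw x)).mul ((hu' x).sub_const p)).const_add p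
  have hf'' : ∀ x, 0 ≤ x →
      0 ≤ deriv S (w x) * (u' x - p) * (u' x - p) + S (w x) * u'' x := fun x hx => by
    rw [mul_assoc]
    exact add_nonneg (mul_nonneg Real.smoothTransition.monotone.deriv_nonneg
      (mul_self_nonneg _)) (mul_nonneg (Real.smoothTransition.nonneg _) (hu'' x hx))
  have hf'0 : f' 0 = p := by
    simp [f', S, Real.smoothTransition.zero_of_nonpos (hw0 0 le_rfl ha)]
  have hf'p : ∀ x, 0 ≤ x → p ≤ f' x := fun x hx => by
    simpa only [hf'0] using le_of_hasDerivAt_nonneg_of_le hf' hx fun y hy _ => hf'' y hy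
  have hfa : ∀ r, 0 ≤ r → r ≤ a → f r = p * r + q := fun r hr hra => by
    simp [f, hm0 _ (hw0 r hr hra)]
  have hderiv : deriv f = f' := funext fun x => (hf x).deriv
  refine ⟨f, hlinec.add (hm.comp hwc), fun r hr => ⟨?_, ?_, ?_⟩, fun r hr => ?_, hfa⟩
  · have h₁ := le_of_hasDerivAt_nonneg_of_le hf hr fun y hy _ => hp.trans (hf'p y hy)
    rw [hfa 0 le_rfl ha] at h₁
    linarith
  · rw [hderiv]
    exact hf'p r hr
  · rw [hderiv, (hf' r).deriv]
    exact hf'' r hr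
  · have h₁ : 1 ≤ w r := by
      simp only [w, huR r hr]
      linarith [hlarge r hr]
    simp only [f, hm1 _ h₁]
    simp only [w, huR r hr]
    ring

/-- Proposition 3.1: for every `R ≥ 37` there exist `C^∞` interpolating functions
`σ, τ : ℝ → ℝ` which are nonnegative with `σ' ≥ 1`, `τ' ≥ 0`, `σ'' ≥ 0`, `τ'' ≥ 0`
on `[0, ∞)`, agree with `sinh`/`cosh` for `r ≥ R`, and with `r`/`1` for `0 ≤ r ≤ 1/R`. -/
theorem interpolating_functions (R : ℝ) (hR : 37 ≤ R) :
    ∃ σ τ : ℝ → ℝ, ContDiff ℝ (⊤ : ℕ∞) σ ∧ ContDiff ℝ (⊤ : ℕ∞) τ ∧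
      (∀ r : ℝ, 0 ≤ r →
        0 ≤ σ r ∧ 0 ≤ τ r ∧ 1 ≤ deriv σ r ∧ 0 ≤ deriv τ r ∧
        0 ≤ deriv (deriv σ) r ∧ 0 ≤ deriv (deriv τ) r) ∧
      (∀ r : ℝ, R ≤ r → σ r = Real.sinh r ∧ τ r = Real.cosh r) ∧
      (∀ r : ℝ, 0 ≤ r → r ≤ 1 / R → σ r = r ∧ τ r = 1) := by
  have hR' : 1 / R ≤ 1 := by rw [div_le_one (by linarith)]; linarith
  have hR0 : 0 ≤ 1 / R := by positivity
  have hexp : ∀ r, 37 ≤ r → 10 * r ≤ Real.exp r ∧ Real.exp (-r) ≤ 1 := fun r hr =>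
    ⟨by nlinarith [Real.quadratic_le_exp_of_nonneg (x := r) (by linarith)],
      Real.exp_le_one_iff.2 (by linarith)⟩
  have hpred : Real.exp R ≤ 3 * Real.exp (R - 1) := by
    have h : Real.exp R = Real.exp 1 * Real.exp (R - 1) := by rw [← Real.exp_add]; ring_nf
    rw [h]
    exact mul_le_mul_of_nonneg_right (by linarith [Real.exp_one_lt_d9]) (Real.exp_pos _).le
  have hpred' : Real.exp (-(R - 1)) ≤ 1 := Real.exp_le_one_iff.2 (by linarith)
  have hRexp := hexp R hR
  have hcosh : Real.exp R / 6 ≤ Real.cosh (R - 1) := by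
    rw [Real.cosh_eq]
    linarith [Real.exp_pos (-(R - 1))]
  have hsinh : Real.exp R / 6 - 1 / 2 ≤ Real.sinh (R - 1) := by
    rw [Real.sinh_eq]
    linarith
  obtain ⟨σ, hσc, hσ, hσR, hσ0⟩ := exists_convex_interpolation (R := R) (a := 1 / R)
    (p := 1) (q := 0) Real.contDiff_sinh Real.hasDerivAt_sinh Real.hasDerivAt_cosh
    (fun x hx => Real.sinh_nonneg_iff.2 hx) (by linarith) hR0 (by linarith) zero_le_one le_rfl
    (fun x hx => by
      have := hexp x (hR.trans hx)
      rw [Real.sinh_eq]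
      linarith)
    (Real.one_le_cosh _)
    (by
      have : Real.sinh R ≤ Real.exp R / 2 := by
        rw [Real.sinh_eq]
        linarith [Real.exp_pos (-R)]
      nlinarith)
  obtain ⟨τ, hτc, hτ, hτR, hτ0⟩ := exists_convex_interpolation (R := R) (a := 1 / R)
    (p := 0) (q := 1) Real.contDiff_cosh Real.hasDerivAt_cosh Real.hasDerivAt_sinh
    (fun x _ => (Real.cosh_pos x).le) (by linarith) hR0 (by linarith) le_rfl zero_le_one
    (fun x hx => by
      have := hexp x (hR.trans hx)
      rw [Real.cosh_eq]
      linarith [Real.exp_pos (-x)])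
    (by linarith)
    (by
      have : Real.cosh R ≤ Real.exp R / 2 + 1 / 2 := by
        rw [Real.cosh_eq]
        linarith
      nlinarith)
  refine ⟨σ, τ, hσc, hτc, fun r hr => ?_, fun r hr => ⟨hσR r hr, hτR r hr⟩,
    fun r hr hra => ⟨by simpa using hσ0 r hr hra, by simpa using hτ0 r hr hra⟩⟩
  obtain ⟨h₁, h₂, h₃⟩ := hσ r hr
  obtain ⟨k₁, k₂, k₃⟩ := hτ r hr
  exact ⟨h₁, k₁, h₂, k₂, h₃, k₃⟩
end

section
/- Let F be a finite field of odd cardinality q, let n ≥ 1 be a natural number, and let λ be a generator of the multiplicative group Fˣ (i.e. λ has multiplicative order q − 1). Then there exists a matrix A of size (2n+1) × (2n+1) over F with Aᵀ · A = I and det A = 1 whose characteristic polynomial equals (X − 1) · (X − λ)^n · (X − λ⁻¹)^n. In particular, the special orthogonal group of the standard quadratic form in 2n+1 variables over F contains an element with n eigenvalues equal to λ, n eigenvalues equal to λ⁻¹, and one eigenvalue equal to 1. -/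
open Polynomial

namespace Matrix

/-- The polynomial `p` is the characteristic polynomial of an orthogonal matrix indexed by `ι`. -/
def IsOrthogonalCharpoly {R : Type*} [CommRing R] (ι : Type*) [Fintype ι] [DecidableEq ι]
    (p : R[X]) : Prop :=
  ∃ A : Matrix ι ι R, A.transpose * A = 1 ∧ A.charpoly = p

namespace IsOrthogonalCharpoly

variable {R : Type*} [CommRing R] {ι κ : Type*} [Fintype ι] [DecidableEq ι] [Fintype κ]
  [DecidableEq κ] {p r : R[X]}

theorem sum (hp : IsOrthogonalCharpoly ι p) (hr : IsOrthogonalCharpoly κ r) :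
    IsOrthogonalCharpoly (ι ⊕ κ) (p * r) := by
  obtain ⟨A, hA, rfl⟩ := hp
  obtain ⟨B, hB, rfl⟩ := hr
  exact ⟨fromBlocks A 0 0 B, by simp [fromBlocks_transpose, fromBlocks_multiply, hA, hB],
    charpoly_fromBlocks_zero₁₂ ..⟩

theorem congr (e : ι ≃ κ) (hp : IsOrthogonalCharpoly ι p) : IsOrthogonalCharpoly κ p := by
  obtain ⟨A, hA, rfl⟩ := hp
  refine ⟨reindex e e A, ?_, charpoly_reindex e A⟩
  rw [transpose_reindex, reindex_apply, reindex_apply, submatrix_mul_equiv, hA,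
    submatrix_one_equiv]

/-- Rodrigues' rotation formula about the axis `(x, y, 0)`. -/
theorem fin_three {x y a t : R} (hxy : x ^ 2 + y ^ 2 = -1) (hat : a ^ 2 - t ^ 2 = 1) :
    IsOrthogonalCharpoly (Fin 3) ((X - C 1) * ((X - C (a + t)) * (X - C (a - t)))) := by
  refine ⟨!![a - (1 - a) * x ^ 2, -((1 - a) * x * y), t * y;
      -((1 - a) * x * y), a - (1 - a) * y ^ 2, -(t * x);
      -(t * y), t * x, a], ?_, ?_⟩
  · ext i j
    fin_cases i <;> fin_cases j <;>
      simp [mul_apply, Fin.sum_univ_three] <;> grind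
  · have hxy' : (C x : R[X]) ^ 2 + C y ^ 2 = -1 := by simpa using congrArg C hxy
    have hat' : (C a : R[X]) ^ 2 - C t ^ 2 = 1 := by simpa using congrArg C hat
    simp [charpoly, charmatrix, det_fin_three]
    grind

/-- Left multiplication by the quaternion `a + t * x * i + t * y * j`. -/
theorem fin_four {x y a t : R} (hxy : x ^ 2 + y ^ 2 = -1) (hat : a ^ 2 - t ^ 2 = 1) :
    IsOrthogonalCharpoly (Fin 4) (((X - C (a + t)) * (X - C (a - t))) ^ 2) := by
  refine ⟨!![a, -(t * x), -(t * y), 0;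
      t * x, a, 0, t * y;
      t * y, 0, a, -(t * x);
      0, -(t * y), t * x, a], ?_, ?_⟩
  · ext i j
    fin_cases i <;> fin_cases j <;>
      simp [mul_apply, Fin.sum_univ_four] <;> grind
  · have hxy' : (C x : R[X]) ^ 2 + C y ^ 2 = -1 := by simpa using congrArg C hxy
    simp [charpoly, charmatrix, det_succ_row_zero, Fin.sum_univ_succ, Fin.succAbove]
    grind

theorem fin_odd {x y a t : R} (hxy : x ^ 2 + y ^ 2 = -1) (hat : a ^ 2 - t ^ 2 = 1) (n : ℕ) :
    IsOrthogonalCharpoly (Fin (2 * n + 1))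
      ((X - C 1) * ((X - C (a + t)) * (X - C (a - t))) ^ n) := by
  induction n using Nat.twoStepInduction with
  | zero => exact ⟨1, by simp, by simp [charpoly_one]⟩
  | one => simpa using fin_three hxy hat
  | more n ih _ =>
    have h := (ih.sum (fin_four hxy hat)).congr
      (finSumFinEquiv.trans (finCongr (by ring : 2 * n + 1 + 4 = 2 * (n + 2) + 1)))
    rwa [mul_assoc, ← pow_add] at h

end IsOrthogonalCharpoly

end Matrix

theorem FiniteField.exists_sq_add_sq_eq_neg_one (F : Type*) [Field F] [Fintype F]
    (hF : Odd (Fintype.card F)) : ∃ x y : F, x ^ 2 + y ^ 2 = -1 := by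
  obtain ⟨x, y, h⟩ := FiniteField.exists_root_sum_quadratic (R := F) (f := X ^ 2) (g := X ^ 2 + C 1)
    (by simp) (by compute_degree!) (Nat.odd_iff.mp hF)
  exact ⟨x, y, by simp at h; linear_combination h⟩

/-- Lemma 2.3(a): over a finite field `F` of odd cardinality `q`, if `λ` generates `Fˣ`,
then the special orthogonal group of the standard form in `2n+1` variables contains an
element with `n` eigenvalues `λ`, `n` eigenvalues `λ⁻¹`, and one eigenvalue `1`. -/
theorem so_odd_element_with_eigenvalues
    (F : Type) [Field F] [Fintype F] (q : ℕ) (hq : Fintype.card F = q) (hodd : Odd q)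
    (n : ℕ) (hn : 1 ≤ n) (lam : Fˣ) (hlam : ∀ x : Fˣ, x ∈ Subgroup.zpowers lam) :
    ∃ A : Matrix (Fin (2 * n + 1)) (Fin (2 * n + 1)) F,
      A.transpose * A = 1 ∧ A.det = 1 ∧
      A.charpoly = (X - C 1) * (X - C (lam : F)) ^ n * (X - C ((lam⁻¹ : Fˣ) : F)) ^ n := by
  subst hq
  obtain ⟨x, y, hxy⟩ := FiniteField.exists_sq_add_sq_eq_neg_one F hodd
  have h2 : (2 : F) ≠ 0 := Ring.two_ne_zero fun h =>
    Nat.not_even_iff_odd.mpr hodd (Nat.even_iff.mpr (FiniteField.even_card_of_char_two h))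
  have hmul : (lam : F) * ((lam⁻¹ : Fˣ) : F) = 1 := lam.mul_inv
  generalize ((lam⁻¹ : Fˣ) : F) = m at *
  generalize (lam : F) = l at *
  have hat : ((l + m) / 2) ^ 2 - ((l - m) / 2) ^ 2 = 1 := by
    field_simp
    linear_combination 4 * hmul
  obtain ⟨A, hA, hchar⟩ := Matrix.IsOrthogonalCharpoly.fin_odd hxy hat n
  rw [show (l + m) / 2 + (l - m) / 2 = l by field_simp; ring,
    show (l + m) / 2 - (l - m) / 2 = m by field_simp; ring] at hchar
  refine ⟨A, hA, ?_, by rw [hchar, mul_pow, mul_assoc]⟩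
  rw [Matrix.det_eq_sign_charpoly_coeff, hchar, coeff_zero_eq_eval_zero]
  simp [hmul, pow_succ, pow_mul]
end

section
/- Let F be a finite field of odd cardinality q, let E be a field extension of F with q² elements, let λ be a generator of the multiplicative group Fˣ, and let μ ∈ Eˣ be an element of multiplicative order exactly q + 1. Let α ∈ F be such that the binary quadratic form x² + αy² is anisotropic over F (i.e. x² + αy² = 0 with x, y ∈ F implies x = y = 0). For n ≥ 1 let J be the 2n × 2n block-diagonal matrix over F consisting of n − 1 blocks [[0,1],[1,0]] followed by one block diag(1, α). Then there exists a 2n × 2n matrix A over F with Aᵀ · J · A = J and det A = 1 whose characteristic polynomial, viewed in E[X], equals (X − λ)^{n−1} · (X − λ⁻¹)^{n−1} · (X − μ) · (X − μ⁻¹). -/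
open Polynomial

/-- The Gram matrix of the form `B_h ⊕ ⋯ ⊕ B_h ⊕ B_a` on `F^{2n}`: `n - 1` hyperbolic
blocks `[[0,1],[1,0]]` followed by the anisotropic block `diag(1, α)`. -/
def minusFormMatrix (F : Type) [Field F] (α : F) (n : ℕ) :
    Matrix (Fin (2 * n)) (Fin (2 * n)) F := fun i j =>
  if (i : ℕ) < 2 * (n - 1) then
    (if (i : ℕ) / 2 = (j : ℕ) / 2 ∧ i ≠ j then 1 else 0)
  else if i = j then (if (i : ℕ) = 2 * n - 2 then 1 else α) else 0

/-- In an extension `E` of a finite field `F`, the elements fixed by the `|F|`-power map come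
from `F`. -/
lemma exists_algebraMap_eq_of_pow_card_eq {F E : Type*} [Field F] [Fintype F] [Field E]
    [Algebra F E] {x : E} (hx : x ^ Fintype.card F = x) : ∃ a : F, algebraMap F E a = x := by
  have hs : (X ^ Fintype.card F - X : F[X]).Splits := by
    rw [splits_iff_card_roots, FiniteField.roots_X_pow_card_sub_X,
      FiniteField.X_pow_card_sub_X_natDegree_eq F Fintype.one_lt_card]
    rfl
  have h0 : (X ^ Fintype.card F - X : F[X]) ≠ 0 :=
    FiniteField.X_pow_card_sub_X_ne_zero F Fintype.one_lt_card
  refine hs.mem_range_of_isRoot h0 ?_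
  simp [hx]

/-- In a finite field, the product of two nonsquares is a square. -/
lemma isSquare_mul_of_not_isSquare {F : Type*} [Field F] [Fintype F] {a b : F}
    (ha : ¬ IsSquare a) (hb : ¬ IsSquare b) : IsSquare (a * b) := by
  classical
  have hab : a * b ≠ 0 := by
    rintro h
    rcases mul_eq_zero.mp h with rfl | rfl
    · exact ha IsSquare.zero
    · exact hb IsSquare.zero
  rw [← quadraticChar_one_iff_isSquare hab, map_mul,
    quadraticChar_neg_one_iff_not_isSquare.mpr ha, quadraticChar_neg_one_iff_not_isSquare.mpr hb]
  norm_num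

/-- If `x ^ 2 + α * y ^ 2` is anisotropic over `F` and `μ ^ (|F| + 1) = 1` with `μ ^ 2 ≠ 1`, then
`(μ + μ⁻¹) / 2` is the first coordinate of an `F`-point of the conic `x ^ 2 + α * y ^ 2 = 1`. -/
lemma exists_point_on_anisotropic_conic {F E : Type*} [Field F] [Fintype F] [Field E]
    [Algebra F E] (h2 : (2 : F) ≠ 0) {μ : E} (hμ : μ ^ (Fintype.card F + 1) = 1)
    (hμ2 : μ ^ 2 ≠ 1) {α : F} (hα : ∀ x y : F, x ^ 2 + α * y ^ 2 = 0 → x = 0 ∧ y = 0) :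
    ∃ a c : F, a ^ 2 + α * c ^ 2 = 1 ∧ algebraMap F E (2 * a) = μ + μ⁻¹ := by
  have h2E : (2 : E) ≠ 0 := by
    rw [← map_ofNat (algebraMap F E)]
    exact (map_ne_zero (algebraMap F E)).mpr h2
  have hμ0 : μ ≠ 0 := by
    rintro rfl
    simp at hμ
  have hpow : μ ^ Fintype.card F = μ⁻¹ := by
    rw [pow_succ] at hμ
    exact eq_inv_of_mul_eq_one_left hμ
  have hfrob (x : E) : x ^ Fintype.card F = FiniteField.frobeniusAlgHom F E x := rfl
  obtain ⟨t, ht⟩ := exists_algebraMap_eq_of_pow_card_eq (F := F) (x := μ + μ⁻¹) (by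
    rw [hfrob, map_add, map_inv₀, ← hfrob, hpow, inv_inv, add_comm])
  set a := t / 2 with ha
  have hta : t = 2 * a := by rw [ha]; field_simp
  have haE : algebraMap F E (2 * a) = μ + μ⁻¹ := by rw [← hta, ht]
  have hα0 : α ≠ 0 := by
    rintro rfl
    simpa using hα 0 1
  have hnα : ¬ IsSquare (-α) := by
    rintro ⟨s, hs⟩
    simpa using hα s 1 (by linear_combination -hs)
  have hna : ¬ IsSquare (a ^ 2 - 1) := by
    rintro ⟨s, hs⟩
    have hE : (algebraMap F E (2 * s)) ^ 2 = (μ - μ⁻¹) ^ 2 := by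
      have h4 : (2 * s) ^ 2 = (2 * a) ^ 2 - 4 := by linear_combination -4 * hs
      rw [← map_pow, h4, map_sub, map_pow, haE, map_ofNat]
      field_simp
      ring
    obtain ⟨u, hu⟩ : ∃ u : F, algebraMap F E u = μ - μ⁻¹ := by
      rcases sq_eq_sq_iff_eq_or_eq_neg.mp hE with h | h
      · exact ⟨_, h⟩
      · exact ⟨-(2 * s), by rw [map_neg, h, neg_neg]⟩
    have hfix : (μ - μ⁻¹) ^ Fintype.card F = μ - μ⁻¹ := by
      rw [← hu, ← map_pow, FiniteField.pow_card]
    rw [hfrob, map_sub, map_inv₀, ← hfrob, hpow, inv_inv] at hfix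
    have h0 : μ - μ⁻¹ = 0 := by
      have : 2 * (μ - μ⁻¹) = 0 := by linear_combination -hfix
      exact (mul_eq_zero.mp this).resolve_left h2E
    apply hμ2
    field_simp at h0
    linear_combination h0
  obtain ⟨d, hd⟩ := isSquare_mul_of_not_isSquare hna hnα
  refine ⟨a, d / α, ?_, haE⟩
  field_simp
  linear_combination -hd

/-- The index equivalence splitting `2 * (m + 1)` coordinates into `m` consecutive pairs
followed by one last pair. -/
def pairsEquiv (m : ℕ) : (Fin m × Fin 2) ⊕ Fin 2 ≃ Fin (2 * (m + 1)) :=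
  ((finProdFinEquiv.sumCongr (Equiv.refl _)).trans finSumFinEquiv).trans
    (finCongr (by ring))

lemma pairsEquiv_inl (m : ℕ) (k : Fin m) (i : Fin 2) :
    (pairsEquiv m (Sum.inl (k, i)) : ℕ) = i + 2 * k := by
  simp [pairsEquiv]

lemma pairsEquiv_inr (m : ℕ) (i : Fin 2) :
    (pairsEquiv m (Sum.inr i) : ℕ) = 2 * m + i := by
  simp [pairsEquiv, mul_comm]

lemma minusFormMatrix_submatrix_pairsEquiv {F : Type} [Field F] (α : F) (m : ℕ) :
    (minusFormMatrix F α (m + 1)).submatrix (pairsEquiv m) (pairsEquiv m) =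
      Matrix.fromBlocks
        (Matrix.of fun x y => if x.1 = y.1 ∧ x.2 ≠ y.2 then 1 else 0) 0 0
        (Matrix.diagonal ![1, α]) := by
  ext x y
  rcases x with ⟨k, i⟩ | i <;> rcases y with ⟨l, j⟩ | j
  · have h1 : (i + 2 * k : ℕ) / 2 = k := by omega
    have h2 : (j + 2 * l : ℕ) / 2 = l := by omega
    have h3 : (i + 2 * k : ℕ) < 2 * m := by omega
    simp only [Matrix.submatrix_apply, minusFormMatrix, pairsEquiv_inl, h1, h2,
      Matrix.fromBlocks_apply₁₁, Matrix.of_apply, add_tsub_cancel_right, h3, if_true,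
      (pairsEquiv m).injective.ne_iff, ne_eq, Sum.inl.injEq, Prod.mk.injEq, Fin.ext_iff]
    congr 1
    simp only [eq_iff_iff]
    tauto
  · have h3 : (i + 2 * k : ℕ) < 2 * m := by omega
    have h4 : ¬ (i + 2 * k : ℕ) / 2 = (2 * m + j) / 2 := by omega
    simp [minusFormMatrix, pairsEquiv_inl, pairsEquiv_inr, h3, h4]
  · simp [minusFormMatrix, pairsEquiv_inr]
  · fin_cases i <;> fin_cases j <;>
      simp [minusFormMatrix, pairsEquiv_inr, mul_add]

/-- Lemma 2.3(c): the special orthogonal group `SO₋(2n, q)` of the form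
`B_h ⊕ ⋯ ⊕ B_h ⊕ B_a` over a finite field `F` of odd cardinality `q` contains an element
with `n - 1` eigenvalues `λ`, `n - 1` eigenvalues `λ⁻¹`, and one eigenvalue each equal to
`μ, μ⁻¹`, where `λ` generates `Fˣ` and `μ ∈ Eˣ` has order `q + 1` in the quadratic
extension `E` of `F`. -/
theorem so_minus_element_with_eigenvalues
    (F : Type) [Field F] [Fintype F] (q : ℕ) (hq : Fintype.card F = q) (hodd : Odd q)
    (E : Type) [Field E] [Fintype E] [Algebra F E] (hE : Fintype.card E = q ^ 2)
    (lam : Fˣ) (hlam : ∀ x : Fˣ, x ∈ Subgroup.zpowers lam)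
    (μ : Eˣ) (hμ : orderOf μ = q + 1)
    (α : F) (hα : ∀ x y : F, x ^ 2 + α * y ^ 2 = 0 → x = 0 ∧ y = 0)
    (n : ℕ) (hn : 1 ≤ n) :
    ∃ A : Matrix (Fin (2 * n)) (Fin (2 * n)) F,
      A.transpose * minusFormMatrix F α n * A = minusFormMatrix F α n ∧ A.det = 1 ∧
      (A.charpoly).map (algebraMap F E) =
        (X - C (algebraMap F E (lam : F))) ^ (n - 1) *
        (X - C (algebraMap F E ((lam⁻¹ : Fˣ) : F))) ^ (n - 1) *
        (X - C (μ : E)) * (X - C ((μ⁻¹ : Eˣ) : E)) := by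
  subst hq
  have h1q : 1 < Fintype.card F := Fintype.one_lt_card
  have h2 : (2 : F) ≠ 0 := by
    refine Ring.two_ne_zero fun h => ?_
    have := FiniteField.even_card_of_char_two h
    rw [Nat.odd_iff] at hodd
    omega
  have hμ1 : (μ : E) ^ (Fintype.card F + 1) = 1 := by
    rw [← hμ, ← Units.val_pow_eq_pow_val, pow_orderOf_eq_one, Units.val_one]
  have hμ2 : (μ : E) ^ 2 ≠ 1 := by
    intro h
    have hu : μ ^ 2 = 1 := Units.ext h
    have := Nat.le_of_dvd two_pos (orderOf_dvd_of_pow_eq_one hu)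
    omega
  obtain ⟨a, c, hac, ha⟩ := exists_point_on_anisotropic_conic h2 hμ1 hμ2 hα
  obtain ⟨m, rfl⟩ : ∃ m, n = m + 1 := ⟨n - 1, by omega⟩
  let d : Fin m × Fin 2 → F := fun x => ![(lam : F), ((lam⁻¹ : Fˣ) : F)] x.2
  let R : Matrix (Fin 2) (Fin 2) F := !![a, -(α * c); c, a]
  have hRdet : R.det = 1 := by
    rw [Matrix.det_fin_two_of]
    linear_combination hac
  have hR : R.transpose * Matrix.diagonal ![1, α] * R = Matrix.diagonal ![1, α] := by
    ext i j
    fin_cases i <;> fin_cases j <;>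
      simp [R, Matrix.mul_apply, Fin.sum_univ_two, Matrix.diagonal_apply]
    · linear_combination hac
    · ring
    · ring
    · linear_combination α * hac
  let B := Matrix.fromBlocks (Matrix.diagonal d) 0 0 R
  have hB : B.transpose * (minusFormMatrix F α (m + 1)).submatrix (pairsEquiv m) (pairsEquiv m) * B
      = (minusFormMatrix F α (m + 1)).submatrix (pairsEquiv m) (pairsEquiv m) := by
    rw [minusFormMatrix_submatrix_pairsEquiv]
    simp only [B, Matrix.fromBlocks_transpose, Matrix.fromBlocks_multiply, Matrix.transpose_zero,
      Matrix.zero_mul, Matrix.mul_zero, add_zero, zero_add, hR, Matrix.diagonal_transpose]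
    congr 1
    ext ⟨k, i⟩ ⟨l, j⟩
    rw [Matrix.mul_diagonal, Matrix.diagonal_mul]
    fin_cases i <;> fin_cases j <;> simp [d]
  refine ⟨Matrix.reindex (pairsEquiv m) (pairsEquiv m) B, ?_, ?_, ?_⟩
  · have := congrArg (Matrix.reindex (pairsEquiv m) (pairsEquiv m)) hB
    simpa [Matrix.submatrix_mul_equiv, ← Matrix.submatrix_mul_equiv _ _ _ (pairsEquiv m).symm]
      using this
  · rw [Matrix.det_reindex_self, Matrix.det_fromBlocks_zero₂₁, hRdet, Matrix.det_diagonal,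
      Fintype.prod_prod_type]
    simp [d]
  · rw [Matrix.charpoly_reindex, Matrix.charpoly_fromBlocks_zero₂₁, Matrix.charpoly_diagonal,
      Fintype.prod_prod_type, Matrix.charpoly_fin_two, hRdet]
    have htr : R.trace = 2 * a := by
      rw [Matrix.trace_fin_two_of]
      ring
    have hμμ : C (μ : E) * C ((μ⁻¹ : Eˣ) : E) = 1 := by
      rw [← C_mul, Units.mul_inv, C_1]
    rw [htr]
    simp only [d, Fin.prod_univ_two, Finset.prod_const, Finset.card_univ, Fintype.card_fin,
      Matrix.cons_val_zero, Matrix.cons_val_one, Polynomial.map_mul, Polynomial.map_pow,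
      Polynomial.map_sub, Polynomial.map_add, map_X, map_C, ha, add_tsub_cancel_right, mul_pow,
      C_add, C_1, Polynomial.map_one, ← Units.val_inv_eq_inv_val]
    linear_combination -(X - C (algebraMap F E (lam : F))) ^ m *
        (X - C (algebraMap F E ((lam⁻¹ : Fˣ) : F))) ^ m * hμμ
end

section
/- Let F be a finite field of odd cardinality q and let α ∈ F be such that the binary quadratic form x² + αy² is anisotropic over F (i.e. x² + αy² = 0 with x, y ∈ F implies x = y = 0). Let D = diag(1, α) and let G = { A : A is a 2 × 2 matrix over F with Aᵀ · D · A = D and det A = 1 }. Then G has exactly q + 1 elements, and G is cyclic under matrix multiplication: there exists g ∈ G such that every element of G is a power of g. -/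
namespace QuadraticAlgebra

variable {F : Type*} [Field F]

/-- Left multiplication on `QuadraticAlgebra F (-α) 0`, as a matrix in the basis `1, ω`. -/
def mulMatrix (α : F) : QuadraticAlgebra F (-α) 0 →* Matrix (Fin 2) (Fin 2) F where
  toFun z := !![z.re, -α * z.im; z.im, z.re]
  map_one' := by
    ext i j
    fin_cases i <;> fin_cases j <;> simp [re_one, im_one]
  map_mul' z w := by
    ext i j
    fin_cases i <;> fin_cases j <;> simp [Matrix.mul_apply, Fin.sum_univ_two] <;> ring

theorem mulMatrix_apply (α : F) (z : QuadraticAlgebra F (-α) 0) :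
    mulMatrix α z = !![z.re, -α * z.im; z.im, z.re] := rfl

theorem mulMatrix_injective (α : F) : Function.Injective (mulMatrix α) := by
  intro z w h
  rw [mulMatrix_apply, mulMatrix_apply] at h
  ext
  · simpa using congrFun (congrFun h 0) 0
  · simpa using congrFun (congrFun h 1) 0

/-- The special orthogonal matrices of `diag(1, α)` are the multiplications by elements of
norm one. -/
theorem exists_mulMatrix_eq_iff (α : F) (A : Matrix (Fin 2) (Fin 2) F) :
    (A.transpose * Matrix.diagonal ![1, α] * A = Matrix.diagonal ![1, α] ∧ A.det = 1) ↔
      ∃ z : QuadraticAlgebra F (-α) 0, norm z = 1 ∧ mulMatrix α z = A := by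
  constructor
  · rintro ⟨h, hdet⟩
    have h00 := congrFun (congrFun h 0) 0
    have h01 := congrFun (congrFun h 0) 1
    simp only [Matrix.mul_apply, Fin.sum_univ_two, Matrix.transpose_apply, Matrix.diagonal_apply,
      Matrix.cons_val_zero, Matrix.cons_val_one, Fin.isValue, if_true, zero_ne_one, one_ne_zero,
      if_false] at h00 h01
    rw [Matrix.det_fin_two] at hdet
    have hd : A 1 1 = A 0 0 := by
      linear_combination (-A 1 1) * h00 + A 1 0 * h01 + A 0 0 * hdet
    have hb : A 0 1 = -α * A 1 0 := by
      linear_combination (-A 0 1) * h00 + A 0 0 * h01 - α * A 1 0 * hdet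
    refine ⟨⟨A 0 0, A 1 0⟩, ?_, ?_⟩
    · rw [norm_def]
      linear_combination h00
    · rw [mulMatrix_apply, Matrix.eta_fin_two A, hd, hb]
      simp
  · rintro ⟨z, hz, rfl⟩
    rw [norm_def] at hz
    rw [mulMatrix_apply]
    constructor
    · ext i j
      fin_cases i <;> fin_cases j <;>
        simp [Matrix.mul_apply, Fin.sum_univ_two, Matrix.diagonal_apply]
      · linear_combination hz
      · ring
      · ring
      · linear_combination α * hz
    · rw [Matrix.det_fin_two_of]
      linear_combination hz

theorem norm_surjective_of_finite [Fintype F] (hodd : Odd (Fintype.card F)) {α : F}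
    (hα : α ≠ 0) : Function.Surjective (norm : QuadraticAlgebra F (-α) 0 →* F) := by
  intro c
  obtain ⟨x, y, h⟩ := FiniteField.exists_root_sum_quadratic
    (f := Polynomial.C 1 * Polynomial.X ^ 2 + Polynomial.C 0 * Polynomial.X + Polynomial.C (-c))
    (g := Polynomial.C α * Polynomial.X ^ 2 + Polynomial.C 0 * Polynomial.X + Polynomial.C 0)
    (Polynomial.degree_quadratic one_ne_zero) (Polynomial.degree_quadratic hα)
    (Nat.odd_iff.mp hodd)
  refine ⟨⟨x, y⟩, ?_⟩
  simp only [Polynomial.eval_add, Polynomial.eval_mul, Polynomial.eval_C, Polynomial.eval_pow,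
    Polynomial.eval_X] at h
  rw [norm_def]
  linear_combination h

theorem card_ker_unitsMap_norm [Fintype F] (hodd : Odd (Fintype.card F)) {α : F} (hα : α ≠ 0)
    [Fact (∀ r : F, r ^ 2 ≠ -α + 0 * r)] :
    Nat.card (Units.map (norm : QuadraticAlgebra F (-α) 0 →* F)).ker = Fintype.card F + 1 := by
  have : Finite (QuadraticAlgebra F (-α) 0) := .of_equiv _ (equivProd (-α) 0).symm
  set f := Units.map (norm : QuadraticAlgebra F (-α) 0 →* F)
  have hf : Function.Surjective f := by
    intro u
    obtain ⟨z, hz⟩ := norm_surjective_of_finite hodd hα (u : F)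
    have hz0 : z ≠ 0 := by
      rintro rfl
      exact u.ne_zero (by rw [← hz, norm_zero])
    exact ⟨Units.mk0 z hz0, Units.ext hz⟩
  have h := f.ker.card_mul_index
  rw [Subgroup.index_ker, MonoidHom.range_eq_top.mpr hf, Subgroup.card_top, Nat.card_units,
    Nat.card_units, Nat.card_congr (equivProd (-α) 0), Nat.card_prod,
    Nat.card_eq_fintype_card (α := F)] at h
  have hq : 0 < Fintype.card F - 1 := Nat.sub_pos_of_lt Fintype.one_lt_card
  refine Nat.eq_of_mul_eq_mul_right hq (h.trans ?_)
  exact Nat.mul_self_sub_mul_self_eq _ 1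

end QuadraticAlgebra

/-- The special orthogonal group `SO(B_a, 𝔽_q)` of the anisotropic binary form
`diag(1, α)` over a finite field of odd cardinality `q` is cyclic of order `q + 1`. -/
theorem so_anisotropic_cyclic_of_order_q_add_one
    (F : Type) [Field F] [Fintype F] (q : ℕ) (hq : Fintype.card F = q) (hodd : Odd q)
    (α : F) (hα : ∀ x y : F, x ^ 2 + α * y ^ 2 = 0 → x = 0 ∧ y = 0) :
    Nat.card {A : Matrix (Fin 2) (Fin 2) F //
        A.transpose * Matrix.diagonal ![1, α] * A = Matrix.diagonal ![1, α] ∧ A.det = 1}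
      = q + 1 ∧
    ∃ g : Matrix (Fin 2) (Fin 2) F,
      (g.transpose * Matrix.diagonal ![1, α] * g = Matrix.diagonal ![1, α] ∧ g.det = 1) ∧
      ∀ A : Matrix (Fin 2) (Fin 2) F,
        (A.transpose * Matrix.diagonal ![1, α] * A = Matrix.diagonal ![1, α] ∧ A.det = 1) →
        ∃ m : ℕ, A = g ^ m := by
  subst hq
  have hα0 : α ≠ 0 := by
    rintro rfl
    exact one_ne_zero (hα 0 1 (by simp)).2
  have : Fact (∀ r : F, r ^ 2 ≠ -α + 0 * r) :=
    ⟨fun r hr => one_ne_zero (hα r 1 (by linear_combination hr)).2⟩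
  have : Finite (QuadraticAlgebra F (-α) 0) := .of_equiv _ (QuadraticAlgebra.equivProd (-α) 0).symm
  let N := (Units.map (QuadraticAlgebra.norm : QuadraticAlgebra F (-α) 0 →* F)).ker
  let φ : N →* Matrix (Fin 2) (Fin 2) F :=
    (QuadraticAlgebra.mulMatrix α).comp ((Units.coeHom _).comp N.subtype)
  have hφ : Function.Injective φ :=
    (QuadraticAlgebra.mulMatrix_injective α).comp (Units.val_injective.comp N.subtype_injective)
  have hrange (A : Matrix (Fin 2) (Fin 2) F) :
      (A.transpose * Matrix.diagonal ![1, α] * A = Matrix.diagonal ![1, α] ∧ A.det = 1) ↔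
        A ∈ Set.range φ := by
    rw [QuadraticAlgebra.exists_mulMatrix_eq_iff]
    constructor
    · rintro ⟨z, hz, rfl⟩
      have hz0 : z ≠ 0 := by
        rintro rfl
        simp at hz
      exact ⟨⟨Units.mk0 z hz0, Units.ext hz⟩, rfl⟩
    · rintro ⟨u, rfl⟩
      exact ⟨_, congrArg Units.val u.2, rfl⟩
  simp only [hrange]
  refine ⟨?_, ?_⟩
  · rw [← QuadraticAlgebra.card_ker_unitsMap_norm hodd hα0]
    exact (Nat.card_congr (Equiv.ofInjective φ hφ)).symm
  · obtain ⟨g, hg⟩ := IsCyclic.exists_generator (α := N)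
    refine ⟨φ g, ⟨g, rfl⟩, ?_⟩
    rintro _ ⟨u, rfl⟩
    obtain ⟨m, rfl⟩ := mem_powers_iff_mem_zpowers.mpr (hg u)
    exact ⟨m, map_pow φ g m⟩
end

section
/- Let l ≥ 1, let Y ⊆ ℝ^l be a compact convex set with nonempty interior, and let A be a surjective isometry of ℝ^l having no fixed point. Then vol_l(Y ∪ A(Y)) > vol_l(Y). -/
open MeasureTheory

/-- A nonexpansive self-map of a nonempty compact convex set has a fixed point. -/
theorem LipschitzWith.exists_fixedPoint_of_isCompact_convex {E : Type*} [NormedAddCommGroup E]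
    [NormedSpace ℝ E] {s : Set E} (hs : IsCompact s) (hconv : Convex ℝ s) (hne : s.Nonempty)
    {f : E → E} (hf : LipschitzWith 1 f) (hmaps : Set.MapsTo f s s) : ∃ x ∈ s, f x = x := by
  obtain ⟨x₀, hx₀⟩ := hne
  obtain ⟨x, hx, hmin⟩ := hs.exists_isMinOn ⟨x₀, hx₀⟩
    (hf.continuous.dist continuous_id).continuousOn
  refine ⟨x, hx, dist_le_zero.mp (le_of_forall_pos_le_add fun ε hε => ?_)⟩
  obtain ⟨D, hD, hDdist⟩ : ∃ D > 0, ∀ y ∈ s, dist (f y) x₀ ≤ D :=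
    ⟨Metric.diam s + 1, by positivity, fun y hy =>
      (Metric.dist_le_diam_of_mem hs.isBounded (hmaps hy) hx₀).trans (by linarith)⟩
  obtain ⟨t, ht₀, ht₁, htD⟩ : ∃ t : ℝ, 0 < t ∧ t ≤ 1 ∧ t * D ≤ ε :=
    ⟨min 1 (ε / D), by positivity, min_le_left _ _,
      (mul_le_mul_of_nonneg_right (min_le_right _ _) hD.le).trans
        (div_mul_cancel₀ _ hD.ne').le⟩
  let g : E → E := fun y => (1 - t) • f y + t • x₀
  have hgmaps : Set.MapsTo g s s := fun y hy =>
    hconv (hmaps hy) hx₀ (by linarith) ht₀.le (by ring)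
  have hg : LipschitzWith (Real.toNNReal (1 - t)) g := by
    refine LipschitzWith.of_dist_le_mul fun y z => ?_
    rw [Real.coe_toNNReal _ (by linarith), dist_add_right, dist_smul₀, Real.norm_eq_abs,
      abs_of_nonneg (by linarith)]
    exact mul_le_mul_of_nonneg_left (by simpa using hf.dist_le_mul y z) (by linarith)
  have hcontr : ContractingWith (Real.toNNReal (1 - t)) (hgmaps.restrict g s s) :=
    ⟨by rw [Real.toNNReal_lt_one]; linarith, fun y z => hg y z⟩
  obtain ⟨y, hy, hfix, -⟩ := hcontr.exists_fixedPoint' hs.isComplete hgmaps hx₀ (edist_ne_top _ _)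
  have hfix' : (1 - t) • f y + t • x₀ = y := hfix
  calc dist (f x) x ≤ dist (f y) y := hmin hy
    _ = t * dist (f y) x₀ := by
      have h : f y - y = t • (f y - x₀) := by
        nth_rewrite 2 [← hfix']
        module
      rw [dist_eq_norm, h, norm_smul, Real.norm_eq_abs, abs_of_pos ht₀, dist_eq_norm]
    _ ≤ t * D := mul_le_mul_of_nonneg_left (hDdist y hy) ht₀.le
    _ ≤ 0 + ε := by linarith

/-- If a homeomorphic image of a compact regular set adds no volume to it, the image lies in it. -/
theorem Homeomorph.mapsTo_of_measure_union_image_le {X : Type*} [TopologicalSpace X] [T2Space X]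
    [MeasurableSpace X] [BorelSpace X] {μ : Measure X} [μ.IsOpenPosMeasure]
    [IsFiniteMeasureOnCompacts μ] {s : Set X} (hs : IsCompact s)
    (hreg : s ⊆ closure (interior s)) (f : X ≃ₜ X) (h : μ (s ∪ f '' s) ≤ μ s) :
    Set.MapsTo f s s := by
  have hdiff : μ (f '' s \ s) = 0 := by
    rw [← Set.union_sdiff_left, measure_sdiff Set.subset_union_left
      hs.measurableSet.nullMeasurableSet hs.measure_lt_top.ne]
    exact tsub_eq_zero_of_le h
  have hopen : IsOpen (f '' interior s \ s) :=
    (f.isOpenMap _ isOpen_interior).sdiff hs.isClosed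
  have hempty : f '' interior s \ s = ∅ := hopen.eq_empty_of_measure_zero
    (measure_mono_null (Set.sdiff_subset_sdiff_left (Set.image_mono interior_subset)) hdiff)
  have hint : Set.MapsTo f (interior s) s :=
    Set.mapsTo_iff_image_subset.mpr (Set.sdiff_eq_empty.mp hempty)
  have hclosure := hint.closure f.continuous
  rw [hs.isClosed.closure_eq] at hclosure
  exact hclosure.mono_left hreg

/-- Lemma 4.6: if `Y ⊆ ℝ^l` is compact convex with nonempty interior and `A` is a
surjective isometry of `ℝ^l` with no fixed point (nonzero translational part), then
`vol(Y ∪ A(Y)) > vol(Y)`. -/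
theorem volume_union_image_gt_of_no_fixed_point
    (l : ℕ) (hl : 1 ≤ l) (Y : Set (EuclideanSpace ℝ (Fin l)))
    (hYc : IsCompact Y) (hYconv : Convex ℝ Y) (hYint : (interior Y).Nonempty)
    (A : EuclideanSpace ℝ (Fin l) ≃ᵢ EuclideanSpace ℝ (Fin l))
    (hA : ∀ x, A x ≠ x) :
    volume Y < volume (Y ∪ A '' Y) := by
  by_contra h
  have hreg : Y ⊆ closure (interior Y) := by
    rw [hYconv.closure_interior_eq_closure_of_nonempty_interior hYint]
    exact subset_closure
  obtain ⟨x, -, hx⟩ := A.isometry.lipschitz.exists_fixedPoint_of_isCompact_convex hYc hYconv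
    (hYint.mono interior_subset)
    (A.toHomeomorph.mapsTo_of_measure_union_image_le hYc hreg (not_lt.mp h))
  exact hA x hx
end

section
/- Let l ≥ 1 and let 0 < δ ≤ R. In the space of nonempty compact subsets of ℝ^l equipped with the Hausdorff distance, the subset C^l_{R,δ} consisting of all compact connected subsets of the closed ball of radius R about the origin which contain the open ball of radius δ about the origin is compact. In particular C^l_{R,δ} with the Hausdorff distance is a compact metric space. -/
open TopologicalSpace Metric

/-- In a Hausdorff space, the preconnected nonempty compact sets form a closed set in the
Vietoris topology. -/
theorem TopologicalSpace.NonemptyCompacts.isClosed_setOf_isPreconnected {α : Type*}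
    [TopologicalSpace α] [T2Space α] :
    IsClosed {K : NonemptyCompacts α | IsPreconnected (K : Set α)} := by
  rw [← isOpen_compl_iff, isOpen_iff_mem_nhds]
  intro K hK
  rw [Set.mem_compl_iff, Set.mem_ofPred_eq, isPreconnected_closed_iff] at hK
  push Not at hK
  obtain ⟨t, t', ht, ht', hKtt', ⟨x, hxK, hxt⟩, ⟨y, hyK, hyt'⟩, hdisj⟩ := hK
  have hsep : Disjoint ((K : Set α) ∩ t) ((K : Set α) ∩ t') := by
    rw [Set.disjoint_iff_inter_eq_empty, ← Set.inter_inter_distrib_left, hdisj]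
  obtain ⟨U, V, hU, hV, htU, htV, hUV⟩ :=
    SeparatedNhds.of_isCompact_isCompact (K.isCompact.inter_right ht)
      (K.isCompact.inter_right ht') hsep
  have hKUV : (K : Set α) ⊆ U ∪ V := fun z hz =>
    (hKtt' hz).imp (fun h => htU ⟨hz, h⟩) (fun h => htV ⟨hz, h⟩)
  filter_upwards [(isOpen_subsets_of_isOpen (hU.union hV)).mem_nhds hKUV,
    (isOpen_inter_nonempty_of_isOpen hU).mem_nhds ⟨x, hxK, htU ⟨hxK, hxt⟩⟩,
    (isOpen_inter_nonempty_of_isOpen hV).mem_nhds ⟨y, hyK, htV ⟨hyK, hyt'⟩⟩]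
    with L hLUV hLU hLV hL
  obtain ⟨z, -, hzU, hzV⟩ := hL U V hU hV hLUV hLU hLV
  exact hUV.le_bot ⟨hzU, hzV⟩

/-- In a `T1` space, the nonempty compact sets containing a given set form a closed set in the
Vietoris topology. -/
theorem TopologicalSpace.NonemptyCompacts.isClosed_setOf_superset {α : Type*}
    [TopologicalSpace α] [T1Space α] (s : Set α) :
    IsClosed {K : NonemptyCompacts α | s ⊆ (K : Set α)} := by
  have h : {K : NonemptyCompacts α | s ⊆ (K : Set α)} =
      ⋂ x ∈ s, {K : NonemptyCompacts α | ((K : Set α) ∩ {x}).Nonempty} := by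
    ext K
    simp [Set.subset_def]
  rw [h]
  exact isClosed_biInter fun x _ => isClosed_inter_nonempty_of_isClosed isClosed_singleton

/-- Theorem 4.4 (Blaschke selection variant): in the space of nonempty compact subsets
of `ℝ^l` with the Hausdorff distance, the collection `C^l_{R,δ}` of compact connected
subsets of the closed `R`-ball about `0` containing the open `δ`-ball about `0`
is compact. -/
theorem blaschke_selection_variant
    (l : ℕ) (hl : 1 ≤ l) (R δ : ℝ) (hδ : 0 < δ) (hδR : δ ≤ R) :
    IsCompact {K : NonemptyCompacts (EuclideanSpace ℝ (Fin l)) |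
      IsConnected (K : Set (EuclideanSpace ℝ (Fin l))) ∧
      (K : Set (EuclideanSpace ℝ (Fin l))) ⊆ closedBall (0 : EuclideanSpace ℝ (Fin l)) R ∧
      ball (0 : EuclideanSpace ℝ (Fin l)) δ ⊆ (K : Set (EuclideanSpace ℝ (Fin l)))} := by
  have hconn : IsClosed {K : NonemptyCompacts (EuclideanSpace ℝ (Fin l)) |
      IsConnected (K : Set (EuclideanSpace ℝ (Fin l)))} := by
    simpa [IsConnected, NonemptyCompacts.nonempty] using
      NonemptyCompacts.isClosed_setOf_isPreconnected (α := EuclideanSpace ℝ (Fin l))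
  exact ((NonemptyCompacts.isCompact_subsets_of_isCompact
    (isCompact_closedBall (0 : EuclideanSpace ℝ (Fin l)) R)).inter_right
      (NonemptyCompacts.isClosed_setOf_superset (ball 0 δ))).inter_left hconn
end

section
/- Let l ≥ 1, let A be a surjective isometry of ℝ^l, and let Y ⊆ ℝ^l be a nonempty compact set with A(Y) ⊆ Y. Then A has a fixed point: there exists x ∈ ℝ^l with A(x) = x. -/
/-- A bounded nonempty subset of a proper metric space has a minimal enclosing closed ball. -/
lemma exists_minimal_enclosing_closedBall {X : Type*} [MetricSpace X] [ProperSpace X]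
    {Y : Set X} (hYne : Y.Nonempty) (hYb : Bornology.IsBounded Y) :
    ∃ (c : X) (r : ℝ), Y ⊆ Metric.closedBall c r ∧
      ∀ (x : X) (s : ℝ), Y ⊆ Metric.closedBall x s → r ≤ s := by
  obtain ⟨y₀, hy₀⟩ := hYne
  let D := Metric.diam Y
  let K : Set (X × ℝ) := {p | ∀ y ∈ Y, dist y p.1 ≤ p.2} ∩ Metric.closedBall y₀ D ×ˢ Set.Icc 0 D
  have hclosed : IsClosed {p : X × ℝ | ∀ y ∈ Y, dist y p.1 ≤ p.2} := by
    simp only [Set.ofPred_forall]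
    exact isClosed_biInter fun y _ => isClosed_le (by fun_prop) (by fun_prop)
  have hK : IsCompact K :=
    ((isCompact_closedBall y₀ D).prod isCompact_Icc).inter_left hclosed
  have hD : 0 ≤ D := Metric.diam_nonneg
  have hmem : (y₀, D) ∈ K :=
    ⟨fun y hy => Metric.dist_le_diam_of_mem hYb hy hy₀, Metric.mem_closedBall_self hD, hD, le_rfl⟩
  obtain ⟨⟨c, r⟩, hcr, hmin⟩ := hK.exists_isMinOn ⟨_, hmem⟩ continuous_snd.continuousOn
  refine ⟨c, r, fun y hy => hcr.1 y hy, fun x s hxs => ?_⟩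
  rcases le_total s D with hs | hs
  · have hy₀x : dist y₀ x ≤ s := hxs hy₀
    have hxK : (x, s) ∈ K :=
      ⟨fun y hy => hxs hy, Metric.mem_closedBall'.2 (hy₀x.trans hs), dist_nonneg.trans hy₀x, hs⟩
    exact hmin hxK
  · exact (hmin hmem).trans hs

/-- In a real inner product space, the center of a minimal enclosing closed ball is unique. -/
lemma eq_of_minimal_enclosing_closedBall {E : Type*} [NormedAddCommGroup E]
    [InnerProductSpace ℝ E] {Y : Set E} (hYne : Y.Nonempty) {c c' : E} {r : ℝ}
    (hc : Y ⊆ Metric.closedBall c r) (hc' : Y ⊆ Metric.closedBall c' r)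
    (hmin : ∀ (x : E) (s : ℝ), Y ⊆ Metric.closedBall x s → r ≤ s) : c = c' := by
  have key : ∀ y ∈ Y, dist y (midpoint ℝ c c') ^ 2 ≤ r ^ 2 - (dist c c' / 2) ^ 2 := by
    intro y hy
    have h₁ : dist y c ≤ r := hc hy
    have h₂ : dist y c' ≤ r := hc' hy
    have h := EuclideanGeometry.dist_sq_add_dist_sq_eq_two_mul_dist_midpoint_sq_add_half_dist_sq
      y c c'
    have h₃ := pow_le_pow_left₀ dist_nonneg h₁ 2
    have h₄ := pow_le_pow_left₀ dist_nonneg h₂ 2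
    linarith
  have hr : r ≤ √(r ^ 2 - (dist c c' / 2) ^ 2) :=
    hmin (midpoint ℝ c c') _ fun y hy => Real.le_sqrt_of_sq_le (key y hy)
  obtain ⟨y, hy⟩ := hYne
  have hr₀ : 0 ≤ r := dist_nonneg.trans (hc hy)
  have hpos : 0 ≤ r ^ 2 - (dist c c' / 2) ^ 2 := (sq_nonneg _).trans (key y hy)
  have h := (Real.le_sqrt hr₀ hpos).1 hr
  have : dist c c' = 0 := by nlinarith [sq_nonneg (dist c c')]
  exact dist_eq_zero.1 this

/-- If a surjective isometry `A` of `ℝ^l` maps a nonempty compact set `Y` into itself,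
then `A` has a fixed point (the center of the minimal enclosing ball of `Y`). -/
theorem isometry_fixed_point_of_maps_compact_into_self
    (l : ℕ) (hl : 1 ≤ l)
    (A : EuclideanSpace ℝ (Fin l) ≃ᵢ EuclideanSpace ℝ (Fin l))
    (Y : Set (EuclideanSpace ℝ (Fin l))) (hYne : Y.Nonempty) (hYc : IsCompact Y)
    (hAY : A '' Y ⊆ Y) :
    ∃ x : EuclideanSpace ℝ (Fin l), A x = x := by
  obtain ⟨c, r, hc, hmin⟩ := exists_minimal_enclosing_closedBall hYne hYc.isBounded
  have hc' : Y ⊆ Metric.closedBall (A.symm c) r := by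
    intro y hy
    have h : dist (A y) c ≤ r := hc (hAY ⟨y, hy, rfl⟩)
    rwa [← A.apply_symm_apply c, A.dist_eq] at h
  exact ⟨c, A.toEquiv.eq_symm_apply.1 (eq_of_minimal_enclosing_closedBall hYne hc hc' hmin)⟩
end

section
/- Fix a real number k ≥ 18. Define f_k : ℝ → ℝ by f_k(x) = exp(−k² / (k² − x²)) for |x| < k and f_k(x) = 0 for |x| ≥ k; define F_k(x) = ∫_{−k}^{x} f_k(s) ds and ρ(r) = F_k(r − (k + 1/k)) / F_k(k). Then ρ is infinitely differentiable and nondecreasing, satisfies 0 ≤ ρ(r) ≤ 1 for all r, ρ(r) = 0 for all r ≤ 1/k, ρ(r) = 1 for all r ≥ 2k + 1/k, and ρ''(r) + ρ(r) ≥ 0 for all r ∈ ℝ. -/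
theorem expNegInvGlue_hasDerivAt (y : ℝ) :
    HasDerivAt expNegInvGlue (y⁻¹ ^ 2 * expNegInvGlue y) y := by
  simpa using expNegInvGlue.hasDerivAt_polynomial_eval_inv_mul 1 y

theorem inv_sq_mul_expNegInvGlue_le_two (y : ℝ) : y⁻¹ ^ 2 * expNegInvGlue y ≤ 2 := by
  rcases le_or_gt y 0 with hy | hy
  · simp [expNegInvGlue.zero_of_nonpos hy]
  · have h := Real.quadratic_le_exp_of_nonneg (inv_pos.2 hy).le
    have h0 := inv_pos.2 hy
    rw [expNegInvGlue, if_neg hy.not_ge, Real.exp_neg, mul_inv_le_iff₀ (Real.exp_pos _)]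
    nlinarith

theorem one_ninth_le_expNegInvGlue_half : 1 / 9 ≤ expNegInvGlue (1 / 2) := by
  have h := Real.exp_one_lt_d9
  have h2 : Real.exp 2 = Real.exp 1 ^ 2 := by rw [← Real.exp_nat_mul]; norm_num
  have h3 : (0 : ℝ) < Real.exp 1 := Real.exp_pos 1
  have h4 : expNegInvGlue (1 / 2) = (Real.exp 2)⁻¹ := by
    rw [expNegInvGlue, if_neg (by norm_num), Real.exp_neg]; norm_num
  rw [h4, one_div]
  apply inv_anti₀ (Real.exp_pos _)
  rw [h2]
  nlinarith

/-- The bump-function construction in the proof of Proposition 3.1: for `k ≥ 18`, the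
function `ρ(r) = F_k(r - (k + 1/k)) / F_k(k)`, where `F_k(x) = ∫_{-k}^x f_k` and
`f_k(x) = exp(-k²/(k² - x²))` for `|x| < k` and `0` otherwise, is smooth, nondecreasing,
takes values in `[0,1]`, equals `0` for `r ≤ 1/k`, equals `1` for `r ≥ 2k + 1/k`, and
satisfies `ρ'' + ρ ≥ 0`. -/
theorem bump_interpolation_properties (k : ℝ) (hk : 18 ≤ k)
    (f : ℝ → ℝ)
    (hf : ∀ x : ℝ, f x = if |x| < k then Real.exp (-(k ^ 2) / (k ^ 2 - x ^ 2)) else 0)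
    (F : ℝ → ℝ) (hF : ∀ x : ℝ, F x = ∫ s in (-k)..x, f s)
    (ρ : ℝ → ℝ) (hρ : ∀ r : ℝ, ρ r = F (r - (k + 1 / k)) / F k) :
    ContDiff ℝ (⊤ : ℕ∞) ρ ∧ Monotone ρ ∧
    (∀ r : ℝ, 0 ≤ ρ r ∧ ρ r ≤ 1) ∧
    (∀ r : ℝ, r ≤ 1 / k → ρ r = 0) ∧
    (∀ r : ℝ, 2 * k + 1 / k ≤ r → ρ r = 1) ∧
    (∀ r : ℝ, 0 ≤ deriv (deriv ρ) r + ρ r) := by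
  have k0 : 0 < k := by linarith
  have hfg : f = fun x => expNegInvGlue (1 - x ^ 2 / k ^ 2) := by
    funext x
    rw [hf, expNegInvGlue]
    have hiff : |x| < k ↔ ¬ (1 - x ^ 2 / k ^ 2 ≤ 0) := by
      rw [not_le, sub_pos, div_lt_one (by positivity), sq_lt_sq, abs_of_pos k0]
    by_cases h : |x| < k
    · rw [if_pos h, if_neg (hiff.1 h)]
      have h1 := not_le.1 (hiff.1 h)
      have h2 : k ^ 2 - x ^ 2 = k ^ 2 * (1 - x ^ 2 / k ^ 2) := by field_simp
      rw [h2]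
      congr 1
      field_simp
    · rw [if_neg h, if_pos (not_not.1 (mt hiff.2 h))]
  have f_smooth : ContDiff ℝ (⊤ : ℕ∞) f := by
    rw [hfg]
    exact expNegInvGlue.contDiff.comp (by fun_prop)
  have f_cont : Continuous f := f_smooth.continuous
  have f_int (a b : ℝ) : IntervalIntegrable f MeasureTheory.volume a b :=
    f_cont.intervalIntegrable a b
  have f_nonneg (x : ℝ) : 0 ≤ f x := by rw [hfg]; exact expNegInvGlue.nonneg _
  have f_zero (x : ℝ) (hx : k ≤ |x|) : f x = 0 := by rw [hf, if_neg hx.not_gt]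
  have f_deriv (x : ℝ) : HasDerivAt f ((1 - x ^ 2 / k ^ 2)⁻¹ ^ 2 *
      expNegInvGlue (1 - x ^ 2 / k ^ 2) * (-(2 * x / k ^ 2))) x := by
    rw [hfg]
    refine (expNegInvGlue_hasDerivAt _).comp x ?_
    simpa using ((hasDerivAt_pow 2 x).div_const (k ^ 2)).const_sub 1
  have F_sub (x y : ℝ) : F y - F x = ∫ s in x..y, f s := by
    rw [hF, hF, intervalIntegral.integral_interval_sub_left (f_int _ _) (f_int _ _)]
  have F_mono : Monotone F := fun x y hxy => by
    rw [← sub_nonneg, F_sub]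
    exact intervalIntegral.integral_nonneg hxy fun s _ => f_nonneg s
  have F_left (x : ℝ) (hx : x ≤ -k) : F x = 0 := by
    rw [hF]
    rw [intervalIntegral.integral_congr (g := fun _ => (0 : ℝ))]
    · simp
    · intro s hs
      rw [Set.uIcc_of_ge hx] at hs
      exact f_zero s (by rw [abs_of_nonpos (by linarith [hs.2])]; linarith [hs.2])
  have F_right (x : ℝ) (hx : k ≤ x) : F x = F k := by
    rw [← sub_eq_zero, F_sub, intervalIntegral.integral_congr (g := fun _ => (0 : ℝ))]
    · simp
    · intro s hs
      rw [Set.uIcc_of_le hx] at hs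
      exact f_zero s (hs.1.trans (le_abs_self s))
  have F_nonneg (x : ℝ) : 0 ≤ F x := by
    rcases le_total x (-k) with h | h
    · rw [F_left x h]
    · rw [← F_left (-k) le_rfl]; exact F_mono h
  have F_le (x : ℝ) : F x ≤ F k := by
    rcases le_total x k with h | h
    · exact F_mono h
    · rw [F_right x h]
  have F_zero : k / 18 ≤ F 0 := by
    have h : ∫ _ in (-(k / 2))..0, (1 / 9 : ℝ) ≤ ∫ s in (-(k / 2))..0, f s := by
      refine intervalIntegral.integral_mono_on (by linarith) (by simp) (f_int _ _) ?_
      intro s hs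
      rw [hfg]
      refine one_ninth_le_expNegInvGlue_half.trans (expNegInvGlue.monotone ?_)
      have : s ^ 2 / k ^ 2 ≤ 1 / 2 := by
        rw [div_le_iff₀ (by positivity)]
        nlinarith [hs.1, hs.2]
      linarith
    rw [← F_sub, intervalIntegral.integral_const, smul_eq_mul] at h
    linarith [F_nonneg (-(k / 2))]
  have Fk_pos : 0 < F k := by linarith [F_le 0]
  have F_deriv (x : ℝ) : HasDerivAt F (f x) x := by
    rw [funext hF]
    exact intervalIntegral.integral_hasDerivAt_right (f_int _ _)
      (f_cont.stronglyMeasurableAtFilter _ _) f_cont.continuousAt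
  have F_smooth : ContDiff ℝ (⊤ : ℕ∞) F := by
    rw [contDiff_infty_iff_deriv, funext fun x => (F_deriv x).deriv]
    exact ⟨fun x => (F_deriv x).differentiableAt, f_smooth⟩
  have ineq (x : ℝ) : 0 ≤ deriv f x + F x := by
    rw [(f_deriv x).deriv]
    have hc := inv_sq_mul_expNegInvGlue_le_two (1 - x ^ 2 / k ^ 2)
    have hc0 : 0 ≤ (1 - x ^ 2 / k ^ 2)⁻¹ ^ 2 * expNegInvGlue (1 - x ^ 2 / k ^ 2) :=
      mul_nonneg (sq_nonneg _) (expNegInvGlue.nonneg _)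
    rcases le_total x 0 with h0 | h0
    · have : 0 ≤ -(2 * x / k ^ 2) := by
        rw [← neg_div]; exact div_nonneg (by linarith) (by positivity)
      linarith [mul_nonneg hc0 this, F_nonneg x]
    rcases le_total k x with h1 | h1
    · have h2 := f_zero x (h1.trans (le_abs_self x))
      rw [hfg] at h2
      simp only at h2
      rw [h2]
      simpa using F_nonneg x
    · have h3 : 2 * x / k ^ 2 ≤ 2 / k := by
        rw [div_le_div_iff₀ (by positivity) k0]; nlinarith
      have h4 : 2 / k ≤ 1 / 9 := by
        rw [div_le_div_iff₀ k0 (by norm_num)]; linarith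
      have h5 : 0 ≤ 2 * x / k ^ 2 := by positivity
      nlinarith [F_mono h0, mul_le_mul hc (h3.trans h4) h5 (by norm_num)]
  have ρ_eq : ρ = fun r => F (r - (k + 1 / k)) / F k := funext hρ
  have ρ_deriv : deriv ρ = fun r => f (r - (k + 1 / k)) / F k := by
    funext r
    rw [ρ_eq]
    exact (((F_deriv _).comp_sub_const r (k + 1 / k)).div_const (F k)).deriv
  have ρ_deriv2 (r : ℝ) : deriv (deriv ρ) r = deriv f (r - (k + 1 / k)) / F k := by
    rw [ρ_deriv]
    exact (((f_deriv _).differentiableAt.hasDerivAt.comp_sub_const r (k + 1 / k)).div_const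
      (F k)).deriv
  refine ⟨?_, ?_, ?_, ?_, ?_, ?_⟩
  · rw [ρ_eq]
    exact (F_smooth.comp (contDiff_id.sub contDiff_const)).div_const _
  · intro r s hrs
    rw [hρ, hρ]
    exact div_le_div_of_nonneg_right (F_mono (by linarith)) Fk_pos.le
  · intro r
    rw [hρ]
    exact ⟨div_nonneg (F_nonneg _) Fk_pos.le, (div_le_one Fk_pos).2 (F_le _)⟩
  · intro r hr
    rw [hρ, F_left _ (by linarith), zero_div]
  · intro r hr
    rw [hρ, F_right _ (by linarith), div_self Fk_pos.ne']
  · intro r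
    rw [ρ_deriv2, hρ, ← add_div]
    exact div_nonneg (ineq _) Fk_pos.le
end

section
/- Let ρ : ℝ → ℝ be twice differentiable with ρ(r) ≥ 0, ρ(r) ≤ 1, ρ'(r) ≥ 0 and ρ''(r) + ρ(r) ≥ 0 for all r ≥ 0. Define σ(r) = ρ(r)·sinh(r) + (1 − ρ(r))·r. Then for all r ≥ 0 one has σ(r) ≥ 0, σ'(r) ≥ 1 and σ''(r) ≥ 0. -/
/-- The first derivative of `s ↦ ρ s * sinh s + (1 - ρ s) * s`. -/
theorem hasDerivAt_mul_sinh_add_one_sub_mul {ρ : ℝ → ℝ} {ρ' r : ℝ} (h : HasDerivAt ρ ρ' r) :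
    HasDerivAt (fun s => ρ s * Real.sinh s + (1 - ρ s) * s)
      (ρ' * (Real.sinh r - r) + ρ r * (Real.cosh r - 1) + 1) r := by
  refine ((h.mul (Real.hasDerivAt_sinh r)).add
    ((h.const_sub 1).mul (hasDerivAt_id' r))).congr_deriv ?_
  ring

/-- The second derivative of `s ↦ ρ s * sinh s + (1 - ρ s) * s`. -/
theorem deriv_deriv_mul_sinh_add_one_sub_mul {ρ : ℝ → ℝ} (hd1 : Differentiable ℝ ρ)
    (hd2 : Differentiable ℝ (deriv ρ)) (r : ℝ) :
    deriv (deriv (fun s => ρ s * Real.sinh s + (1 - ρ s) * s)) r =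
      (deriv (deriv ρ) r + ρ r) * (Real.sinh r - r) + 2 * deriv ρ r * (Real.cosh r - 1)
        + ρ r * r := by
  have hderiv : deriv (fun s => ρ s * Real.sinh s + (1 - ρ s) * s) =
      fun s => deriv ρ s * (Real.sinh s - s) + ρ s * (Real.cosh s - 1) + 1 :=
    funext fun s => (hasDerivAt_mul_sinh_add_one_sub_mul (hd1 s).hasDerivAt).deriv
  rw [hderiv]
  refine HasDerivAt.deriv ((((hd2 r).hasDerivAt.mul
    ((Real.hasDerivAt_sinh r).sub (hasDerivAt_id' r))).add
    ((hd1 r).hasDerivAt.mul ((Real.hasDerivAt_cosh r).sub_const 1))).add_const 1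
    |>.congr_deriv ?_)
  simp only [Pi.sub_apply]
  ring

/-- Convexity verification for `σ(r) = ρ(r) sinh(r) + (1 - ρ(r)) r` in the proof of
Proposition 3.1: if `ρ` is twice differentiable with `0 ≤ ρ ≤ 1`, `ρ' ≥ 0` and
`ρ'' + ρ ≥ 0` on `[0, ∞)`, then `σ ≥ 0`, `σ' ≥ 1` and `σ'' ≥ 0` on `[0, ∞)`. -/
theorem sigma_convexity (ρ : ℝ → ℝ)
    (hd1 : Differentiable ℝ ρ) (hd2 : Differentiable ℝ (deriv ρ))
    (h0 : ∀ r : ℝ, 0 ≤ r → 0 ≤ ρ r) (h1 : ∀ r : ℝ, 0 ≤ r → ρ r ≤ 1)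
    (h2 : ∀ r : ℝ, 0 ≤ r → 0 ≤ deriv ρ r)
    (h3 : ∀ r : ℝ, 0 ≤ r → 0 ≤ deriv (deriv ρ) r + ρ r) :
    ∀ r : ℝ, 0 ≤ r →
      0 ≤ (fun s => ρ s * Real.sinh s + (1 - ρ s) * s) r ∧
      1 ≤ deriv (fun s => ρ s * Real.sinh s + (1 - ρ s) * s) r ∧
      0 ≤ deriv (deriv (fun s => ρ s * Real.sinh s + (1 - ρ s) * s)) r := by
  intro r hr
  have hsinh : 0 ≤ Real.sinh r - r := sub_nonneg.2 (Real.self_le_sinh_iff.2 hr)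
  have hcosh : 0 ≤ Real.cosh r - 1 := sub_nonneg.2 (Real.one_le_cosh r)
  have hρ := h0 r hr
  have hρ' := h2 r hr
  have hρ'' := h3 r hr
  refine ⟨?_, ?_, ?_⟩
  · exact add_nonneg (mul_nonneg hρ (Real.sinh_nonneg_iff.2 hr))
      (mul_nonneg (sub_nonneg.2 (h1 r hr)) hr)
  · rw [(hasDerivAt_mul_sinh_add_one_sub_mul (hd1 r).hasDerivAt).deriv]
    exact le_add_of_nonneg_left (by positivity)
  · rw [deriv_deriv_mul_sinh_add_one_sub_mul hd1 hd2]
    positivity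
end

section
/- Let ρ : ℝ → ℝ be twice differentiable with ρ(r) ≥ 0, ρ(r) ≤ 1, ρ'(r) ≥ 0 and ρ''(r) + ρ(r) ≥ 0 for all r ≥ 0. Define τ(r) = ρ(r)·cosh(r) + (1 − ρ(r)). Then for all r ≥ 0 one has τ(r) ≥ 1, τ'(r) ≥ 0 and τ''(r) ≥ 0. -/
/-- The first derivative of `ρ cosh + (1 - ρ)`. -/
theorem deriv_mul_cosh_add_one_sub {ρ : ℝ → ℝ} (hd : Differentiable ℝ ρ) :
    deriv (fun s => ρ s * Real.cosh s + (1 - ρ s)) =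
      fun s => deriv ρ s * (Real.cosh s - 1) + ρ s * Real.sinh s := by
  funext s
  have hρ := (hd s).hasDerivAt
  refine (((hρ.mul (Real.hasDerivAt_cosh s)).add (hρ.const_sub 1)).congr_deriv ?_).deriv
  ring

/-- The derivative of `ρ' (cosh - 1) + ρ sinh`, as a combination of `ρ'' + ρ`, `ρ'` and `ρ`. -/
theorem deriv_mul_cosh_sub_one_add_mul_sinh {ρ : ℝ → ℝ} (hd1 : Differentiable ℝ ρ)
    (hd2 : Differentiable ℝ (deriv ρ)) (r : ℝ) :
    deriv (fun s => deriv ρ s * (Real.cosh s - 1) + ρ s * Real.sinh s) r =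
      (deriv (deriv ρ) r + ρ r) * (Real.cosh r - 1) + 2 * deriv ρ r * Real.sinh r + ρ r := by
  have hρ := (hd1 r).hasDerivAt
  have hρ' := (hd2 r).hasDerivAt
  refine (((hρ'.mul ((Real.hasDerivAt_cosh r).sub_const 1)).add
    (hρ.mul (Real.hasDerivAt_sinh r))).congr_deriv ?_).deriv
  ring

/-- Convexity verification for `τ(r) = ρ(r) cosh(r) + (1 - ρ(r))` in the proof of
Proposition 3.1: if `ρ` is twice differentiable with `0 ≤ ρ ≤ 1`, `ρ' ≥ 0` and
`ρ'' + ρ ≥ 0` on `[0, ∞)`, then `τ ≥ 1`, `τ' ≥ 0` and `τ'' ≥ 0` on `[0, ∞)`. -/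
theorem tau_convexity (ρ : ℝ → ℝ)
    (hd1 : Differentiable ℝ ρ) (hd2 : Differentiable ℝ (deriv ρ))
    (h0 : ∀ r : ℝ, 0 ≤ r → 0 ≤ ρ r) (h1 : ∀ r : ℝ, 0 ≤ r → ρ r ≤ 1)
    (h2 : ∀ r : ℝ, 0 ≤ r → 0 ≤ deriv ρ r)
    (h3 : ∀ r : ℝ, 0 ≤ r → 0 ≤ deriv (deriv ρ) r + ρ r) :
    ∀ r : ℝ, 0 ≤ r →
      1 ≤ (fun s => ρ s * Real.cosh s + (1 - ρ s)) r ∧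
      0 ≤ deriv (fun s => ρ s * Real.cosh s + (1 - ρ s)) r ∧
      0 ≤ deriv (deriv (fun s => ρ s * Real.cosh s + (1 - ρ s))) r := by
  intro r hr
  have hc : 0 ≤ Real.cosh r - 1 := sub_nonneg.mpr (Real.one_le_cosh r)
  have hs : 0 ≤ Real.sinh r := Real.sinh_nonneg_iff.mpr hr
  have hρ := h0 r hr
  have hρ' := h2 r hr
  have hρ'' := h3 r hr
  rw [deriv_mul_cosh_add_one_sub hd1, deriv_mul_cosh_sub_one_add_mul_sinh hd1 hd2]
  refine ⟨?_, ?_, ?_⟩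
  · have := mul_nonneg hρ hc
    dsimp only
    linarith
  · dsimp only
    positivity
  · positivity
end
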